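/- arXiv:2409.08756 — 3 statements merged into one kernel-verified Lean document; each statement's English description precedes it below -/
import Mathlib

section
/- For the generic quadratic model f with an admissible design x_1,…,x_n, true parameter θ* ∈ ℝ^{d+1}, Gaussian noise of standard deviation σ > 0, arbitrary observations y ∈ ℝ^n, and reference parameter θ̄ = θ̂(y): for every x ∈ [−1,1]^d, the linearization approximation to the prediction uncertainty equals V^LIN(x) = (σ^2/n) (1 + Σ_{k=1}^d (x_k + (β_k/α_k)(x_k^2 − 1) θ̄_k)^2). -/
open Finset MeasureTheory Real

/-- The generic quadratic model
`f(x,θ) = θ₀ + ∑ₖ αₖ θₖ xₖ + ∑ₖ βₖ (θₖ²/2) xₖ²`. -/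
noncomputable def model (d : ℕ) (α β : Fin d → ℝ) (x : Fin d → ℝ)
    (θ : Fin (d + 1) → ℝ) : ℝ :=
  θ 0 + (∑ k, α k * θ k.succ * x k) + (∑ k, β k * (θ k.succ) ^ 2 / 2 * (x k) ^ 2)

/-- Admissibility of an experimental design: all design points are corners of `[-1,1]^d`,
they sum to zero, and the design is orthogonal. -/
def Admissible (d n : ℕ) (X : Fin n → Fin d → ℝ) : Prop :=
  (∀ i k, X i k = 1 ∨ X i k = -1) ∧
  (∀ k, ∑ i, X i k = 0) ∧
  (∀ k l, ∑ i, X i k * X i l = (n : ℝ) * (if k = l then 1 else 0))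

/-- The closed-form least-squares estimator for the generic quadratic model. -/
noncomputable def lse (d n : ℕ) (α β : Fin d → ℝ) (X : Fin n → Fin d → ℝ)
    (y : Fin n → ℝ) : Fin (d + 1) → ℝ :=
  Fin.cons
    ((1 / (n : ℝ)) * (∑ i, y i)
      - ∑ k, β k / (2 * (α k) ^ 2 * (n : ℝ) ^ 2) * (∑ i, X i k * y i) ^ 2)
    (fun k => (1 / (α k * (n : ℝ))) * ∑ i, X i k * y i)

/-- The sum of squared errors. -/
noncomputable def sse (d n : ℕ) (α β : Fin d → ℝ) (X : Fin n → Fin d → ℝ)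
    (y : Fin n → ℝ) (θ : Fin (d + 1) → ℝ) : ℝ :=
  ∑ i, (model d α β (X i) θ - y i) ^ 2

/-- Density of the `n`-dimensional Gaussian with mean `0` and covariance `σ² I`. -/
noncomputable def gauss (n : ℕ) (σ : ℝ) (z : Fin n → ℝ) : ℝ :=
  (2 * π * σ ^ 2) ^ (-(n : ℝ) / 2) * Real.exp (-(∑ i, (z i) ^ 2) / (2 * σ ^ 2))

/-- The noise-free observations `y* = (f(x₁,θ*),…,f(xₙ,θ*))`. -/
noncomputable def yStar (d n : ℕ) (α β : Fin d → ℝ) (X : Fin n → Fin d → ℝ)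
    (θs : Fin (d + 1) → ℝ) : Fin n → ℝ :=
  fun i => model d α β (X i) θs

/-- The expected prediction `μ(x) = ∫ f(x, θ̂(y* + z)) p(z) dz`. -/
noncomputable def predMean (d n : ℕ) (α β : Fin d → ℝ) (X : Fin n → Fin d → ℝ)
    (θs : Fin (d + 1) → ℝ) (σ : ℝ) (x : Fin d → ℝ) : ℝ :=
  ∫ z : Fin n → ℝ, model d α β x (lse d n α β X (yStar d n α β X θs + z)) * gauss n σ z

/-- The prediction uncertainty `V(x) = ∫ (f(x, θ̂(y* + z)) − μ(x))² p(z) dz`. -/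
noncomputable def predVar (d n : ℕ) (α β : Fin d → ℝ) (X : Fin n → Fin d → ℝ)
    (θs : Fin (d + 1) → ℝ) (σ : ℝ) (x : Fin d → ℝ) : ℝ :=
  ∫ z : Fin n → ℝ,
    (model d α β x (lse d n α β X (yStar d n α β X θs + z))
        - predMean d n α β X θs σ x) ^ 2 * gauss n σ z

/-- The gradient `∇_θ f(x,θ̄)` of the generic quadratic model:
`∂f/∂θ₀ = 1` and `∂f/∂θₖ = αₖ xₖ + βₖ θ̄ₖ xₖ²`. -/
noncomputable def gradModel (d : ℕ) (α β : Fin d → ℝ) (x : Fin d → ℝ)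
    (θb : Fin (d + 1) → ℝ) : Fin (d + 1) → ℝ :=
  Fin.cons 1 (fun k => α k * x k + β k * θb k.succ * (x k) ^ 2)

/-- The linearized model `f^LIN_θ̄(x,θ) = f(x,θ̄) + ∇_θ f(x,θ̄)ᵀ (θ − θ̄)`. -/
noncomputable def modelLin (d : ℕ) (α β : Fin d → ℝ) (θb : Fin (d + 1) → ℝ)
    (x : Fin d → ℝ) (θ : Fin (d + 1) → ℝ) : ℝ :=
  model d α β x θb + ∑ j, gradModel d α β x θb j * (θ j - θb j)

/-- `c_θ̄(x) = f(x,θ̄) − ∇_θ f(x,θ̄)ᵀ θ̄`. -/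
noncomputable def cRef (d : ℕ) (α β : Fin d → ℝ) (θb : Fin (d + 1) → ℝ)
    (x : Fin d → ℝ) : ℝ :=
  model d α β x θb - ∑ j, gradModel d α β x θb j * θb j

/-- Sum of squared errors of the linearized model. -/
noncomputable def sseLin (d n : ℕ) (α β : Fin d → ℝ) (X : Fin n → Fin d → ℝ)
    (θb : Fin (d + 1) → ℝ) (y : Fin n → ℝ) (θ : Fin (d + 1) → ℝ) : ℝ :=
  ∑ i, (modelLin d α β θb (X i) θ - y i) ^ 2


open ProbabilityTheory in
lemma aux_int1 (v : NNReal) (hv : v ≠ 0) (m : ℕ) :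
    Integrable (fun t : ℝ => t ^ m * gaussianPDFReal 0 v t) := by
  have h : Integrable (fun t : ℝ => t ^ m) (gaussianReal 0 v) := by
    rcases Nat.eq_zero_or_pos m with rfl | hm
    · simp
    · have := (memLp_id_gaussianReal (μ := 0) (v := v) (m : NNReal)).integrable_norm_pow (by omega)
      refine (integrable_norm_iff (by fun_prop)).1 ?_
      simpa using this
  rw [gaussianReal_of_var_ne_zero _ hv, gaussianPDF_def,
    integrable_withDensity_iff_integrable_smul' (by fun_prop) (by simp)] at h
  refine h.congr (Filter.Eventually.of_forall fun t => ?_)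
  simp [ENNReal.toReal_ofReal (gaussianPDFReal_nonneg 0 v t), mul_comm]

open ProbabilityTheory in
lemma aux_m0 (v : NNReal) (hv : v ≠ 0) : ∫ t : ℝ, t ^ 0 * gaussianPDFReal 0 v t = 1 := by
  simpa using integral_gaussianPDFReal_eq_one 0 hv

open ProbabilityTheory in
lemma aux_m1 (v : NNReal) (hv : v ≠ 0) : ∫ t : ℝ, t ^ 1 * gaussianPDFReal 0 v t = 0 := by
  have := integral_id_gaussianReal (μ := 0) (v := v)
  rw [integral_gaussianReal_eq_integral_smul hv] at this
  simpa [mul_comm] using this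

open ProbabilityTheory in
lemma aux_m2 (v : NNReal) (hv : v ≠ 0) : ∫ t : ℝ, t ^ 2 * gaussianPDFReal 0 v t = v := by
  have := variance_fun_id_gaussianReal (μ := 0) (v := v)
  rw [variance_eq_integral (by fun_prop), integral_id_gaussianReal,
    integral_gaussianReal_eq_integral_smul hv] at this
  simpa [mul_comm] using this

open ProbabilityTheory in
lemma aux_gauss (n : ℕ) (σ : ℝ) (hσ : 0 < σ) (z : Fin n → ℝ) :
    gauss n σ z = ∏ i, gaussianPDFReal 0 (Real.toNNReal (σ ^ 2)) (z i) := by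
  have hp : 0 < 2 * π * σ ^ 2 := by positivity
  simp only [gauss, gaussianPDFReal, Real.coe_toNNReal _ (sq_nonneg σ), Finset.prod_mul_distrib, sub_zero,
    ← Real.exp_sum, Finset.prod_const, Finset.card_univ, Fintype.card_fin]
  congr 1
  · rw [Real.sqrt_eq_rpow, ← Real.rpow_neg hp.le, ← Real.rpow_mul_natCast hp.le]
    congr 1; ring
  · rw [← Finset.sum_div, Finset.sum_neg_distrib]

lemma aux_v (σ : ℝ) (hσ : 0 < σ) : (Real.toNNReal (σ ^ 2)) ≠ 0 := by
  have : 0 < σ ^ 2 := by positivity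
  exact (Real.toNNReal_pos.2 this).ne'

open ProbabilityTheory in
lemma aux_mono (n : ℕ) (σ : ℝ) (hσ : 0 < σ) (e : Fin n → ℕ) :
    Integrable (fun z : Fin n → ℝ => (∏ k, z k ^ e k) * gauss n σ z) ∧
    ∫ z : Fin n → ℝ, (∏ k, z k ^ e k) * gauss n σ z
      = ∏ k, ∫ t : ℝ, t ^ e k * gaussianPDFReal 0 (Real.toNNReal (σ ^ 2)) t := by
  simp_rw [aux_gauss n σ hσ, ← Finset.prod_mul_distrib]
  constructor
  · exact Integrable.fintype_prod (f := fun k (t : ℝ) =>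
      t ^ e k * gaussianPDFReal 0 (Real.toNNReal (σ ^ 2)) t)
      (fun k => aux_int1 _ (aux_v σ hσ) _)
  · exact integral_fintype_prod_volume_eq_prod (fun k (t : ℝ) =>
      t ^ e k * gaussianPDFReal 0 (Real.toNNReal (σ ^ 2)) t)

lemma aux_g0 (n : ℕ) (σ : ℝ) (hσ : 0 < σ) :
    Integrable (fun z : Fin n → ℝ => gauss n σ z) ∧ ∫ z : Fin n → ℝ, gauss n σ z = 1 := by
  have := aux_mono n σ hσ (fun _ => 0)
  simp only [aux_m0 _ (aux_v σ hσ)] at this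
  simpa using this

lemma aux_pow1 (n : ℕ) (i : Fin n) (z : Fin n → ℝ) :
    ∏ k, z k ^ (if k = i then 1 else 0) = z i := by
  simp [Finset.prod_ite_eq', pow_ite]

lemma aux_g1 (n : ℕ) (σ : ℝ) (hσ : 0 < σ) (i : Fin n) :
    Integrable (fun z : Fin n → ℝ => z i * gauss n σ z) ∧
      ∫ z : Fin n → ℝ, z i * gauss n σ z = 0 := by
  have := aux_mono n σ hσ (fun k => if k = i then 1 else 0)
  simp_rw [aux_pow1] at this
  refine ⟨this.1, this.2.trans (Finset.prod_eq_zero (Finset.mem_univ i) ?_)⟩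
  simp only [if_true]
  exact aux_m1 _ (aux_v σ hσ)

lemma aux_g2 (n : ℕ) (σ : ℝ) (hσ : 0 < σ) (i j : Fin n) :
    Integrable (fun z : Fin n → ℝ => z i * z j * gauss n σ z) ∧
      ∫ z : Fin n → ℝ, z i * z j * gauss n σ z = if i = j then σ ^ 2 else 0 := by
  have := aux_mono n σ hσ (fun k => (if k = i then 1 else 0) + (if k = j then 1 else 0))
  simp_rw [pow_add, Finset.prod_mul_distrib, aux_pow1] at this
  refine ⟨this.1, this.2.trans ?_⟩
  simp_rw [← pow_add]
  split_ifs with h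
  · subst h
    rw [Finset.prod_eq_single i]
    · simp only [if_true]
      exact (aux_m2 _ (aux_v σ hσ)).trans (Real.coe_toNNReal _ (sq_nonneg σ))
    · intro b _ hb
      simp only [if_neg hb, add_zero]
      exact aux_m0 _ (aux_v σ hσ)
    · simp
  · refine Finset.prod_eq_zero (Finset.mem_univ i) ?_
    simp only [if_true, if_neg h, add_zero]
    exact aux_m1 _ (aux_v σ hσ)

lemma aux_mean (n : ℕ) (σ : ℝ) (hσ : 0 < σ) (L : Fin n → ℝ) (C : ℝ) :
    ∫ z : Fin n → ℝ, (C + ∑ i, L i * z i) * gauss n σ z = C := by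
  simp_rw [add_mul, Finset.sum_mul, mul_assoc]
  rw [integral_add ((aux_g0 n σ hσ).1.const_mul _)
    (integrable_finsetSum _ fun i _ => (aux_g1 n σ hσ i).1.const_mul _),
    integral_finsetSum _ (fun i _ => (aux_g1 n σ hσ i).1.const_mul _)]
  simp_rw [integral_const_mul, (aux_g0 n σ hσ).2, (aux_g1 n σ hσ _).2]
  simp

lemma aux_var (n : ℕ) (σ : ℝ) (hσ : 0 < σ) (L : Fin n → ℝ) :
    ∫ z : Fin n → ℝ, (∑ i, L i * z i) ^ 2 * gauss n σ z = σ ^ 2 * ∑ i, L i ^ 2 := by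
  have h : ∀ z : Fin n → ℝ, (∑ i, L i * z i) ^ 2 * gauss n σ z
      = ∑ i, ∑ j, (L i * L j) * (z i * z j * gauss n σ z) := by
    intro z
    rw [sq, Finset.sum_mul_sum, Finset.sum_mul]
    refine Finset.sum_congr rfl fun i _ => ?_
    rw [Finset.sum_mul]
    exact Finset.sum_congr rfl fun j _ => by ring
  simp_rw [h]
  rw [integral_finsetSum _ (fun i _ => integrable_finsetSum _
    fun j _ => (aux_g2 n σ hσ i j).1.const_mul _)]
  rw [Finset.mul_sum]
  refine Finset.sum_congr rfl fun i _ => ?_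
  rw [integral_finsetSum _ (fun j _ => (aux_g2 n σ hσ i j).1.const_mul _)]
  simp_rw [integral_const_mul, (aux_g2 n σ hσ _ _).2]
  simp
  ring

lemma aux_normal (n : ℕ) (r g : Fin n → ℝ)
    (h : ∀ s : ℝ, ∑ i, r i ^ 2 ≤ ∑ i, (r i + s * g i) ^ 2) : ∑ i, g i * r i = 0 := by
  set b := ∑ i, g i * r i with hb
  set a := ∑ i, g i ^ 2 with ha
  have ha0 : 0 ≤ a := Finset.sum_nonneg fun i _ => sq_nonneg _
  have h2 : ∀ s : ℝ, 0 ≤ 2 * s * b + s ^ 2 * a := by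
    intro s
    have e : ∑ i, (r i + s * g i) ^ 2 = ∑ i, r i ^ 2 + (2 * s * b + s ^ 2 * a) := by
      rw [hb, ha, Finset.mul_sum, Finset.mul_sum, ← Finset.sum_add_distrib,
        ← Finset.sum_add_distrib]
      exact Finset.sum_congr rfl fun i _ => by ring
    have := h s
    linarith
  have h3 := h2 (-b / (a + 1))
  have e : 2 * (-b / (a + 1)) * b + (-b / (a + 1)) ^ 2 * a
      = -(b ^ 2 * (a + 2)) / (a + 1) ^ 2 := by
    field_simp
    ring
  rw [e, div_nonneg_iff] at h3
  have hp : 0 < (a + 1) ^ 2 := by positivity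
  rcases h3 with h3 | h3
  · have : b ^ 2 ≤ 0 := by nlinarith [h3.1, mul_nonneg (sq_nonneg b) ha0]
    exact pow_eq_zero_iff (two_ne_zero) |>.1 (le_antisymm this (sq_nonneg b))
  · linarith [h3.2]

lemma aux_shift (d : ℕ) (α β : Fin d → ℝ) (θb : Fin (d + 1) → ℝ) (x : Fin d → ℝ)
    (θ : Fin (d + 1) → ℝ) (j : Fin (d + 1)) (s : ℝ) :
    modelLin d α β θb x (fun i => θ i + s * if i = j then 1 else 0)
      = modelLin d α β θb x θ + s * gradModel d α β x θb j := by
  have : ∀ i, gradModel d α β x θb i * (θ i + (s * if i = j then 1 else 0) - θb i)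
    = gradModel d α β x θb i * (θ i - θb i)
      + if i = j then s * gradModel d α β x θb i else 0 := by
    intro i
    split_ifs <;> ring
  simp only [modelLin, this, Finset.sum_add_distrib]
  simp
  ring

lemma aux_pred (d n : ℕ) (hn : 1 ≤ n)
    (α β : Fin d → ℝ) (hα : ∀ k, α k ≠ 0)
    (X : Fin n → Fin d → ℝ) (hX : Admissible d n X) (θb : Fin (d + 1) → ℝ)
    (w : Fin n → ℝ) (t : Fin (d + 1) → ℝ)
    (hmin : ∀ θ : Fin (d + 1) → ℝ, sseLin d n α β X θb w t ≤ sseLin d n α β X θb w θ)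
    (x u : Fin d → ℝ) (hu : ∀ k, u k = x k + β k / α k * ((x k) ^ 2 - 1) * θb k.succ)
    (L : Fin n → ℝ) (hL : ∀ i, L i = 1 / (n : ℝ) * (1 + ∑ k, u k * X i k)) :
    modelLin d α β θb x t
      = (model d α β x θb - ∑ i, L i * model d α β (X i) θb) + ∑ i, L i * w i := by
  obtain ⟨h1, h2, h3⟩ := hX
  have hn0 : (n : ℝ) ≠ 0 := by positivity
  have hN : ∀ j, ∑ i, gradModel d α β (X i) θb j * (modelLin d α β θb (X i) t - w i) = 0 := by
    intro j
    apply aux_normal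
    intro s
    have := hmin (fun i => t i + s * if i = j then 1 else 0)
    simp only [sseLin, aux_shift] at this
    refine this.trans (le_of_eq (Finset.sum_congr rfl fun i _ => by ring))
  have hsq : ∀ i k, X i k ^ 2 = 1 := by
    intro i k
    rcases h1 i k with h | h <;> rw [h] <;> norm_num
  have hN0 : ∑ i, (modelLin d α β θb (X i) t - w i) = 0 := by
    simpa [gradModel] using hN 0
  have hNk : ∀ k, ∑ i, X i k * (modelLin d α β θb (X i) t - w i) = 0 := by
    intro k
    have h := hN k.succ
    simp only [gradModel, Fin.cons_succ, hsq, mul_one, add_mul, Finset.sum_add_distrib,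
      mul_assoc, ← Finset.mul_sum, hN0] at h
    simpa [hα k] using h
  have hLsum : ∀ r : Fin n → ℝ, ∑ i, L i * r i
      = 1 / (n : ℝ) * (∑ i, r i + ∑ k, u k * ∑ i, X i k * r i) := by
    intro r
    simp_rw [hL, mul_assoc, ← Finset.mul_sum, add_mul, Finset.sum_add_distrib, one_mul,
      Finset.sum_mul, Finset.mul_sum]
    rw [Finset.sum_comm]
    simp_rw [mul_assoc]
  have hr : ∑ i, L i * (modelLin d α β θb (X i) t - w i) = 0 := by
    rw [hLsum, hN0]
    simp [hNk]
  have hL1 : ∑ i, L i = 1 := by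
    have := hLsum (fun _ => 1)
    simp [h2, hn0] at this
    exact this
  have hLX : ∀ k, ∑ i, L i * X i k = u k := by
    intro k
    rw [hLsum]
    simp [h2, h3]
    field_simp
  have hg : ∀ j, ∑ i, L i * gradModel d α β (X i) θb j = gradModel d α β x θb j := by
    intro j
    refine Fin.cases ?_ (fun k => ?_) j
    · simpa [gradModel] using hL1
    · simp only [gradModel, Fin.cons_succ, hsq, mul_one]
      have : ∀ i, L i * (α k * X i k + β k * θb k.succ)
        = α k * (L i * X i k) + β k * θb k.succ * L i := fun i => by ring
      simp_rw [this, Finset.sum_add_distrib, ← Finset.mul_sum, hLX, hL1, hu]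
      have := hα k
      field_simp
      ring
  have hfin : ∑ i, L i * modelLin d α β θb (X i) t = ∑ i, L i * w i := by
    simp_rw [mul_sub, Finset.sum_sub_distrib] at hr
    linarith
  rw [← hfin]
  simp only [modelLin, mul_add, Finset.sum_add_distrib, Finset.mul_sum]
  rw [Finset.sum_comm]
  simp_rw [← mul_assoc, ← Finset.sum_mul, hg]
  ring

lemma aux_L2 (d n : ℕ) (hn : 1 ≤ n) (X : Fin n → Fin d → ℝ) (hX : Admissible d n X)
    (u : Fin d → ℝ) :
    ∑ i, (1 / (n : ℝ) * (1 + ∑ k, u k * X i k)) ^ 2 = 1 / (n : ℝ) * (1 + ∑ k, u k ^ 2) := by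
  obtain ⟨h1, h2, h3⟩ := hX
  have hn0 : (n : ℝ) ≠ 0 := by positivity
  have hA : ∑ i, ∑ k, u k * X i k = 0 := by
    rw [Finset.sum_comm]
    simp [← Finset.mul_sum, h2]
  have hB : ∑ i, (∑ k, u k * X i k) ^ 2 = n * ∑ k, u k ^ 2 := by
    simp_rw [sq, Finset.sum_mul_sum]
    rw [Finset.sum_comm, Finset.mul_sum]
    refine Finset.sum_congr rfl fun k _ => ?_
    rw [Finset.sum_comm]
    have : ∀ l i, u k * X i k * (u l * X i l) = u k * u l * (X i k * X i l) :=
      fun l i => by ring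
    simp_rw [this, ← Finset.mul_sum, h3]
    simp
    ring
  have : ∀ i, (1 / (n : ℝ) * (1 + ∑ k, u k * X i k)) ^ 2
    = (1 / (n : ℝ)) ^ 2 * (1 + 2 * (∑ k, u k * X i k) + (∑ k, u k * X i k) ^ 2) :=
    fun i => by ring
  simp_rw [this, ← Finset.mul_sum, Finset.sum_add_distrib, ← Finset.mul_sum, hA, hB]
  simp
  field_simp

/-- Closed-form expression for the linearization approximation to the
prediction uncertainty, with reference parameter `θ̄ = θ̂(y)`. -/
theorem stmt11 (d n : ℕ) (hd : 1 ≤ d) (hn : 1 ≤ n)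
    (α β : Fin d → ℝ) (hα : ∀ k, α k ≠ 0)
    (X : Fin n → Fin d → ℝ) (hX : Admissible d n X)
    (θs : Fin (d + 1) → ℝ) (σ : ℝ) (hσ : 0 < σ)
    (y : Fin n → ℝ) (θb : Fin (d + 1) → ℝ) (hθb : θb = lse d n α β X y)
    (tLin : (Fin n → ℝ) → Fin (d + 1) → ℝ)
    (hmin : ∀ (w : Fin n → ℝ) (θ : Fin (d + 1) → ℝ),
      sseLin d n α β X θb w (tLin w) ≤ sseLin d n α β X θb w θ)
    (x : Fin d → ℝ) (hx : ∀ k, x k ∈ Set.Icc (-1 : ℝ) 1) :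
    (∫ z : Fin n → ℝ,
        (modelLin d α β θb x (tLin (yStar d n α β X θs + z))
            - ∫ w : Fin n → ℝ,
                modelLin d α β θb x (tLin (yStar d n α β X θs + w)) * gauss n σ w) ^ 2
          * gauss n σ z)
      = σ ^ 2 / (n : ℝ)
          * (1 + ∑ k, (x k + β k / α k * ((x k) ^ 2 - 1) * θb k.succ) ^ 2) := by
  set u : Fin d → ℝ := fun k => x k + β k / α k * ((x k) ^ 2 - 1) * θb k.succ with hu
  set L : Fin n → ℝ := fun i => 1 / (n : ℝ) * (1 + ∑ k, u k * X i k) with hL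
  set Y := yStar d n α β X θs with hY
  obtain ⟨C, hC⟩ : ∃ C : ℝ, ∀ z : Fin n → ℝ,
      modelLin d α β θb x (tLin (Y + z)) = C + ∑ i, L i * z i := by
    refine ⟨(model d α β x θb - ∑ i, L i * model d α β (X i) θb) + ∑ i, L i * Y i, fun z => ?_⟩
    rw [aux_pred d n hn α β hα X hX θb (Y + z) (tLin (Y + z)) (hmin _) x u (fun _ => rfl)
      L (fun _ => rfl)]
    simp only [Pi.add_apply, mul_add, Finset.sum_add_distrib]
    ring
  simp_rw [hC, aux_mean n σ hσ L C, add_sub_cancel_left]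
  rw [aux_var n σ hσ L, aux_L2 d n hn X hX u]
  ring
end

section
/- For the generic quadratic model f with an admissible design x_1,…,x_n, observations y ∈ ℝ^n, reference parameter θ̄ = θ̂(y), noise level σ > 0, and sigma-point parameter κ ∈ (−n, ∞): for every x ∈ [−1,1]^d, the sigma-point approximation to the expected prediction equals μ^SP(x) = f(x, θ̄) + (σ^2/(2n)) Σ_{k=1}^d (β_k/α_k^2)(x_k^2 − 1). -/
open Finset MeasureTheory Real

/-- `g(x,z) = f(x, θ̂(ȳ + z))` where `ȳ` are the predictions of the model estimated from `y`. -/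
noncomputable def spG (d n : ℕ) (α β : Fin d → ℝ) (X : Fin n → Fin d → ℝ)
    (y : Fin n → ℝ) (x : Fin d → ℝ) (z : Fin n → ℝ) : ℝ :=
  model d α β x (lse d n α β X ((fun i => model d α β (X i) (lse d n α β X y)) + z))

/-- The sigma-point approximation to the expected prediction. -/
noncomputable def spMean (d n : ℕ) (α β : Fin d → ℝ) (X : Fin n → Fin d → ℝ)
    (y : Fin n → ℝ) (σ κ : ℝ) (x : Fin d → ℝ) : ℝ :=
  (κ / ((n : ℝ) + κ)) * spG d n α β X y x 0
    + (1 / (2 * ((n : ℝ) + κ))) * ∑ i : Fin n,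
        (spG d n α β X y x (fun j => if j = i then σ * Real.sqrt ((n : ℝ) + κ) else 0)
          + spG d n α β X y x (fun j => if j = i then -(σ * Real.sqrt ((n : ℝ) + κ)) else 0))

/-- The sigma-point approximation to the prediction uncertainty. -/
noncomputable def spVar (d n : ℕ) (α β : Fin d → ℝ) (X : Fin n → Fin d → ℝ)
    (y : Fin n → ℝ) (σ κ : ℝ) (x : Fin d → ℝ) : ℝ :=
  (κ / ((n : ℝ) + κ)) * (spG d n α β X y x 0 - spMean d n α β X y σ κ x) ^ 2
    + (1 / (2 * ((n : ℝ) + κ))) * ∑ i : Fin n,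
        ((spG d n α β X y x (fun j => if j = i then σ * Real.sqrt ((n : ℝ) + κ) else 0)
            - spMean d n α β X y σ κ x) ^ 2
          + (spG d n α β X y x (fun j => if j = i then -(σ * Real.sqrt ((n : ℝ) + κ)) else 0)
              - spMean d n α β X y σ κ x) ^ 2)

/-- The model with squares of the design points replaced by one. -/
lemma model_at_design (d n : ℕ) (α β : Fin d → ℝ) (X : Fin n → Fin d → ℝ)
    (hX : Admissible d n X) (θ : Fin (d + 1) → ℝ) (i : Fin n) :
    model d α β (X i) θ
      = (θ 0 + ∑ k, β k * (θ k.succ) ^ 2 / 2) + ∑ k, α k * θ k.succ * X i k := by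
  have h : ∀ k, (X i k) ^ 2 = 1 := by
    intro k
    rcases hX.1 i k with h | h <;> rw [h] <;> norm_num
  unfold model
  simp only [h, mul_one]
  ring

lemma sum_model (d n : ℕ) (α β : Fin d → ℝ) (X : Fin n → Fin d → ℝ)
    (hX : Admissible d n X) (θ : Fin (d + 1) → ℝ) :
    ∑ i, model d α β (X i) θ = n * (θ 0 + ∑ k, β k * (θ k.succ) ^ 2 / 2) := by
  simp only [model_at_design d n α β X hX]
  rw [Finset.sum_add_distrib, Finset.sum_comm]
  simp only [← Finset.mul_sum, hX.2.1]
  simp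
  ring

lemma sum_X_model (d n : ℕ) (α β : Fin d → ℝ) (X : Fin n → Fin d → ℝ)
    (hX : Admissible d n X) (θ : Fin (d + 1) → ℝ) (k : Fin d) :
    ∑ i, X i k * model d α β (X i) θ = n * (α k * θ k.succ) := by
  simp only [model_at_design d n α β X hX, mul_add, Finset.mul_sum]
  rw [Finset.sum_add_distrib]
  have h2 : ∑ i, ∑ l, X i k * (α l * θ l.succ * X i l) = n * (α k * θ k.succ) := by
    rw [Finset.sum_comm]
    have : ∀ l, ∑ i, X i k * (α l * θ l.succ * X i l)
        = α l * θ l.succ * ((n : ℝ) * (if k = l then 1 else 0)) := by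
      intro l
      rw [← hX.2.2 k l, Finset.mul_sum]
      exact Finset.sum_congr rfl fun i _ => by ring
    simp only [this]
    simp
    ring
  have h1 : ∑ i, (X i k * θ 0 + ∑ l, X i k * (β l * (θ l.succ) ^ 2 / 2)) = 0 := by
    have : ∀ i, X i k * θ 0 + ∑ l, X i k * (β l * (θ l.succ) ^ 2 / 2)
        = X i k * (θ 0 + ∑ l, (β l * (θ l.succ) ^ 2 / 2)) := by
      intro i
      rw [← Finset.mul_sum, mul_add]
    simp only [this]
    rw [← Finset.sum_mul, hX.2.1, zero_mul]
  rw [h1, h2, zero_add]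

lemma lse_model (d n : ℕ) (hn : 1 ≤ n) (α β : Fin d → ℝ) (hα : ∀ k, α k ≠ 0)
    (X : Fin n → Fin d → ℝ) (hX : Admissible d n X) (θ : Fin (d + 1) → ℝ) :
    lse d n α β X (fun i => model d α β (X i) θ) = θ := by
  have hn' : (n : ℝ) ≠ 0 := by positivity
  funext j
  unfold lse
  simp only [sum_model d n α β X hX, sum_X_model d n α β X hX]
  refine Fin.cases ?_ (fun k => ?_) j
  · rw [Fin.cons_zero]
    have : ∀ k, β k / (2 * (α k) ^ 2 * (n : ℝ) ^ 2) * (n * (α k * θ k.succ)) ^ 2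
        = β k * (θ k.succ) ^ 2 / 2 := by
      intro k
      have := hα k
      field_simp
    simp only [this]
    field_simp
    ring
  · rw [Fin.cons_succ]
    have := hα k
    field_simp

lemma model_lse (d n : ℕ) (hn : 1 ≤ n) (α β : Fin d → ℝ) (hα : ∀ k, α k ≠ 0)
    (X : Fin n → Fin d → ℝ) (y : Fin n → ℝ) (x : Fin d → ℝ) :
    model d α β x (lse d n α β X y) = (1 / (n : ℝ)) * (∑ i, y i)
      + ∑ k, ((1 / (n : ℝ)) * (∑ i, X i k * y i) * x k
        + β k / (2 * (α k) ^ 2 * (n : ℝ) ^ 2) * (∑ i, X i k * y i) ^ 2 * ((x k) ^ 2 - 1)) := by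
  have hn' : (n : ℝ) ≠ 0 := by positivity
  unfold model lse
  simp only [Fin.cons_zero, Fin.cons_succ]
  rw [sub_add, sub_add, sub_eq_add_neg, add_right_inj, ← Finset.sum_sub_distrib,
    ← Finset.sum_sub_distrib, ← Finset.sum_neg_distrib]
  refine Finset.sum_congr rfl fun k _ => ?_
  have := hα k
  field_simp
  ring

lemma spG_pair (d n : ℕ) (hn : 1 ≤ n) (α β : Fin d → ℝ) (hα : ∀ k, α k ≠ 0)
    (X : Fin n → Fin d → ℝ) (hX : Admissible d n X) (y : Fin n → ℝ) (x : Fin d → ℝ)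
    (i : Fin n) (t : ℝ) :
    spG d n α β X y x (fun j => if j = i then t else 0)
      + spG d n α β X y x (fun j => if j = i then -t else 0)
      = 2 * spG d n α β X y x 0
        + t ^ 2 / (n : ℝ) ^ 2 * ∑ k, β k / (α k) ^ 2 * ((x k) ^ 2 - 1) := by
  have hn' : (n : ℝ) ≠ 0 := by positivity
  have hsq : ∀ k, (X i k) ^ 2 = 1 := by
    intro k
    rcases hX.1 i k with h | h <;> rw [h] <;> norm_num
  unfold spG
  generalize hm : (fun i => model d α β (X i) (lse d n α β X y)) = m
  simp only [model_lse d n hn α β hα, Pi.add_apply, add_zero, mul_add,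
    Finset.sum_add_distrib, mul_ite, mul_zero, Finset.sum_ite_eq', Finset.mem_univ, if_true]
  have key : ∀ A : ℝ, ∀ S P B : Fin d → ℝ, (∀ k, P k ^ 2 = 1) →
    (A + 1 / (n : ℝ) * t + ∑ k, ((1 / (n : ℝ)) * (S k + P k * t) * x k
        + B k / (2 * (α k) ^ 2 * (n : ℝ) ^ 2) * (S k + P k * t) ^ 2 * ((x k) ^ 2 - 1)))
    + (A + 1 / (n : ℝ) * (-t) + ∑ k, ((1 / (n : ℝ)) * (S k + P k * (-t)) * x k
        + B k / (2 * (α k) ^ 2 * (n : ℝ) ^ 2) * (S k + P k * (-t)) ^ 2 * ((x k) ^ 2 - 1)))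
    = 2 * (A + ∑ k, ((1 / (n : ℝ)) * (S k) * x k
        + B k / (2 * (α k) ^ 2 * (n : ℝ) ^ 2) * (S k) ^ 2 * ((x k) ^ 2 - 1)))
      + t ^ 2 / (n : ℝ) ^ 2 * ∑ k, B k / (α k) ^ 2 * ((x k) ^ 2 - 1) := by
    intro A S P B hP
    have : ∀ a b c e f : ℝ, a + b = 2 * c + e * f →
        (A + 1 / (n : ℝ) * t + a) + (A + 1 / (n : ℝ) * (-t) + b) = 2 * (A + c) + e * f := by
      intro a b c e f h
      linear_combination h
    apply this
    rw [Finset.mul_sum, Finset.mul_sum, ← Finset.sum_add_distrib, ← Finset.sum_add_distrib]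
    refine Finset.sum_congr rfl fun k _ => ?_
    have := hα k
    have h2 : B k / (2 * (α k) ^ 2 * (n : ℝ) ^ 2) = B k / (α k) ^ 2 / (n : ℝ) ^ 2 / 2 := by
      field_simp
    rw [h2]
    linear_combination (B k / (α k) ^ 2 / (n : ℝ) ^ 2 * t ^ 2 * ((x k) ^ 2 - 1)) * hP k
  have := key (1 / (n : ℝ) * ∑ i, m i)
    (fun k => ∑ i, X i k * m i) (fun k => X i k) β hsq
  simp only [mul_add, Finset.sum_add_distrib] at this ⊢
  exact this

/-- Closed-form expression for the sigma-point approximation to the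
expected prediction. -/
theorem stmt13 (d n : ℕ) (hd : 1 ≤ d) (hn : 1 ≤ n)
    (α β : Fin d → ℝ) (hα : ∀ k, α k ≠ 0)
    (X : Fin n → Fin d → ℝ) (hX : Admissible d n X)
    (y : Fin n → ℝ) (σ κ : ℝ) (hσ : 0 < σ) (hκ : -(n : ℝ) < κ)
    (x : Fin d → ℝ) (hx : ∀ k, x k ∈ Set.Icc (-1 : ℝ) 1) :
    spMean d n α β X y σ κ x
      = model d α β x (lse d n α β X y)
        + σ ^ 2 / (2 * (n : ℝ)) * ∑ k, β k / (α k) ^ 2 * ((x k) ^ 2 - 1) := by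
  have hn' : (n : ℝ) ≠ 0 := by positivity
  have hpos : 0 < (n : ℝ) + κ := by linarith
  have h0 : spG d n α β X y x 0 = model d α β x (lse d n α β X y) := by
    unfold spG
    rw [add_zero, lse_model d n hn α β hα X hX]
  unfold spMean
  simp only [spG_pair d n hn α β hα X hX, h0]
  rw [Finset.sum_const, Finset.card_univ, Fintype.card_fin, nsmul_eq_mul, mul_pow,
    Real.sq_sqrt hpos.le]
  have := hpos.ne'
  field_simp
  ring
end

section
/- For the generic quadratic model f with an admissible design x_1,…,x_n, true parameter θ* ∈ ℝ^{d+1}, Gaussian noise of standard deviation σ > 0, and noise-free observations y = y* (so that the reference parameter θ̄ = θ̂(y*) equals θ*): for every x ∈ [−1,1]^d, the exact prediction uncertainty exceeds the linearization approximation by exactly V(x) − V^LIN(x) = (σ^4/(2n^2)) Σ_{k=1}^d (β_k^2/α_k^4)(x_k^2 − 1)^2. -/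
open Finset MeasureTheory Real

open ProbabilityTheory in
lemma aux_gauss_prod (n : ℕ) (σ : ℝ) (hσ : 0 < σ) (v : NNReal) (hv : (v : ℝ) = σ ^ 2)
    (z : Fin n → ℝ) : gauss n σ z = ∏ i, gaussianPDFReal 0 v (z i) := by
  unfold gauss
  simp only [gaussianPDFReal, Finset.prod_mul_distrib, Finset.prod_const, Finset.card_univ,
    Fintype.card_fin, hv, sub_zero]
  rw [← Real.exp_sum]
  congr 1
  · have h : (0 : ℝ) < 2 * π * σ ^ 2 := by positivity
    rw [Real.sqrt_eq_rpow, ← Real.rpow_neg h.le, ← Real.rpow_mul_natCast h.le]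
    congr 1
    ring
  · congr 1
    rw [← Finset.sum_div, Finset.sum_neg_distrib]

open ProbabilityTheory in
lemma aux_pi_eq (n : ℕ) (σ : ℝ) (hσ : 0 < σ) (v : NNReal) (hv : (v : ℝ) = σ ^ 2) :
    Measure.pi (fun _ : Fin n => gaussianReal 0 v)
      = (volume : Measure (Fin n → ℝ)).withDensity (fun z => ENNReal.ofReal (gauss n σ z)) := by
  have hv0 : v ≠ 0 := by
    intro h
    rw [h] at hv
    have : 0 < σ ^ 2 := by positivity
    simp at hv
    linarith
  refine Measure.pi_eq fun s hs => ?_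
  rw [withDensity_apply _ (MeasurableSet.univ_pi hs), volume_pi, Measure.restrict_pi_pi,
    ← ofReal_integral_eq_lintegral_ofReal]
  · simp_rw [aux_gauss_prod n σ hσ v hv]
    rw [integral_fintype_prod_eq_prod (𝕜 := ℝ) (fun _ => gaussianPDFReal 0 v),
      ENNReal.ofReal_prod_of_nonneg]
    · exact Finset.prod_congr rfl fun i _ => (gaussianReal_apply_eq_integral 0 hv0 (s i)).symm
    · intro i _
      exact integral_nonneg (gaussianPDFReal_nonneg _ _)
  · have hg : gauss n σ = fun z => ∏ i, gaussianPDFReal 0 v (z i) :=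
      funext fun z => aux_gauss_prod n σ hσ v hv z
    rw [hg]
    exact Integrable.fintype_prod (𝕜 := ℝ) (f := fun _ => gaussianPDFReal 0 v)
      (fun i => (integrable_gaussianPDFReal _ _).restrict)
  · refine Filter.Eventually.of_forall fun z => ?_
    simp only [Pi.zero_apply, gauss]
    positivity

open ProbabilityTheory in
lemma aux_integral (n : ℕ) (σ : ℝ) (hσ : 0 < σ) (v : NNReal) (hv : (v : ℝ) = σ ^ 2)
    (f : (Fin n → ℝ) → ℝ) :
    ∫ z, f z * gauss n σ z = ∫ z, f z ∂(Measure.pi (fun _ : Fin n => gaussianReal 0 v)) := by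
  rw [aux_pi_eq n σ hσ v hv, integral_withDensity_eq_integral_toReal_smul]
  · refine integral_congr_ae (Filter.Eventually.of_forall fun z => ?_)
    have : 0 ≤ gauss n σ z := by unfold gauss; positivity
    simp only [ENNReal.toReal_ofReal this, smul_eq_mul]
    ring
  · unfold gauss; fun_prop
  · exact Filter.Eventually.of_forall fun z => ENNReal.ofReal_lt_top

open ProbabilityTheory in
lemma aux_third (v : NNReal) : ∫ x, x ^ 3 ∂(gaussianReal 0 v) = 0 := by
  have h : (gaussianReal 0 v).map (fun x => -x) = gaussianReal 0 v := by
    rw [gaussianReal_map_neg]; simp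
  have h2 : ∫ x, x ^ 3 ∂(gaussianReal 0 v) = ∫ x, (-x) ^ 3 ∂(gaussianReal 0 v) := by
    conv_lhs => rw [← h]
    rw [integral_map (by fun_prop) (by fun_prop)]
  have h3 : ∀ x : ℝ, (-x) ^ 3 = - x ^ 3 := fun x => by ring
  simp_rw [h3, integral_neg] at h2
  linarith

open ProbabilityTheory in
lemma aux_fourth (v : NNReal) (hv : v ≠ 0) : ∫ x, x ^ 4 ∂(gaussianReal 0 v) = 3 * (v : ℝ) ^ 2 := by
  have hvp : (0 : ℝ) < v := by positivity
  rw [integral_gaussianReal_eq_integral_smul hv]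
  have h0 : ∀ x : ℝ, gaussianPDFReal 0 v x • x ^ 4
      = (√(2 * π * v))⁻¹ * ((fun y => y ^ (4 : ℝ) * Real.exp (-(1 / (2 * (v : ℝ))) * y ^ (2 : ℝ))) |x|) := by
    intro x
    simp only [gaussianPDFReal, smul_eq_mul, sub_zero]
    have e1 : |x| ^ (4 : ℝ) = x ^ 4 := by
      rw [show (4 : ℝ) = ((4 : ℕ) : ℝ) by norm_num, Real.rpow_natCast]
      exact Even.pow_abs (by decide) x
    have e2 : |x| ^ (2 : ℝ) = x ^ 2 := by
      rw [show (2 : ℝ) = ((2 : ℕ) : ℝ) by norm_num, Real.rpow_natCast]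
      exact Even.pow_abs (by decide) x
    rw [e1, e2]
    rw [show -(1 / (2 * (v : ℝ))) * x ^ 2 = -x ^ 2 / (2 * (v : ℝ)) by ring]
    ring
  simp_rw [h0]
  rw [integral_const_mul, integral_comp_abs (f := fun y => y ^ (4 : ℝ) * Real.exp (-(1 / (2 * (v : ℝ))) * y ^ (2 : ℝ))),
    integral_rpow_mul_exp_neg_mul_rpow (by norm_num) (by norm_num) (by positivity)]
  have hG : Real.Gamma ((4 + 1) / 2) = 3 / 4 * √π := by
    rw [show ((4 : ℝ) + 1) / 2 = (1 / 2 + 1) + 1 by norm_num, Real.Gamma_add_one (by norm_num),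
      Real.Gamma_add_one (by norm_num), Real.Gamma_one_half_eq]
    ring
  rw [hG]
  have hp : (1 / (2 * (v : ℝ))) ^ (-(4 + 1) / 2 : ℝ) = (2 * v) ^ 2 * √(2 * v) := by
    rw [one_div, Real.inv_rpow (by positivity), ← Real.rpow_neg (by positivity),
      show -(-(4 + 1) / 2 : ℝ) = (2 : ℕ) + 1 / 2 by norm_num, Real.rpow_add (by positivity),
      Real.rpow_natCast, Real.sqrt_eq_rpow]
  rw [hp, show 2 * π * (v : ℝ) = π * (2 * v) by ring, Real.sqrt_mul pi_pos.le]
  have a1 : √π ≠ 0 := by positivity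
  have a2 : √(2 * (v : ℝ)) ≠ 0 := by positivity
  field_simp
  ring

open ProbabilityTheory in
/-- variance of a quadratic polynomial under a centred Gaussian -/
lemma aux_var_quad (v : NNReal) (hv : v ≠ 0) (a b : ℝ) :
    Var[fun x => a * x + b * x ^ 2; gaussianReal 0 v] = a ^ 2 * v + 2 * b ^ 2 * (v : ℝ) ^ 2 := by
  have hL : ∀ p : ℕ, Integrable (fun x : ℝ => x ^ p) (gaussianReal 0 v) := by
    intro p
    rcases Nat.eq_zero_or_pos p with rfl | hp
    · simp
    have := (memLp_id_gaussianReal (μ := 0) (v := v) (p : NNReal)).integrable_norm_pow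
      (by positivity)
    refine (integrable_norm_iff (by fun_prop)).1 ?_
    simpa using this
  have h1 : ∫ x, x ∂(gaussianReal 0 v) = 0 := integral_id_gaussianReal
  have h2 : ∫ x, x ^ 2 ∂(gaussianReal 0 v) = v := by
    have := variance_fun_id_gaussianReal (μ := 0) (v := v)
    rw [variance_eq_integral (by fun_prop)] at this
    simpa using this
  have i1 : Integrable (fun x : ℝ => x) (gaussianReal 0 v) := by simpa using hL 1
  have hm : ∫ x, (a * x + b * x ^ 2) ∂(gaussianReal 0 v) = b * v := by
    rw [integral_add (i1.const_mul a) ((hL 2).const_mul b), integral_const_mul,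
      integral_const_mul, h1, h2]
    ring
  rw [variance_eq_integral (by fun_prop), hm]
  have e : ∀ x : ℝ, (a * x + b * x ^ 2 - b * v) ^ 2
      = b ^ 2 * x ^ 4 + (2 * a * b) * x ^ 3 + (a ^ 2 - 2 * b ^ 2 * v) * x ^ 2
        + (-2 * a * b * v) * x + b ^ 2 * (v : ℝ) ^ 2 := fun x => by ring
  simp_rw [e]
  have j4 := (hL 4).const_mul (b ^ 2)
  have j3 := (hL 3).const_mul (2 * a * b)
  have j2 := (hL 2).const_mul (a ^ 2 - 2 * b ^ 2 * v)
  have j1 := i1.const_mul (-2 * a * b * v)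
  rw [integral_add (by exact ((j4.add j3).add j2).add j1) (integrable_const _),
    integral_add (by exact (j4.add j3).add j2) j1, integral_add (by exact j4.add j3) j2, integral_add j4 j3,
    integral_const_mul (-2 * a * b * v) (fun x : ℝ => x)]
  simp only [integral_const_mul, h1, h2, aux_third, aux_fourth v hv, integral_const,
    probReal_univ, smul_eq_mul]
  ring

open ProbabilityTheory in
lemma aux_var_main (m n : ℕ) (hn : 1 ≤ n) (v : NNReal) (hv : v ≠ 0) (C : Fin m → Fin n → ℝ)
    (hC : ∀ j l, ∑ i, C j i * C l i = (n : ℝ) * (if j = l then 1 else 0))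
    (a b : Fin m → ℝ) (c : ℝ) :
    Var[fun z => c + ∑ j, (a j * (∑ i, C j i / n * z i) + b j * (∑ i, C j i / n * z i) ^ 2);
      Measure.pi (fun _ : Fin n => gaussianReal 0 v)]
      = ∑ j, (a j ^ 2 * (v / n) + 2 * b j ^ 2 * ((v : ℝ) / n) ^ 2) := by
  have hn0 : (n : ℝ) ≠ 0 := by positivity
  set P := Measure.pi (fun _ : Fin n => gaussianReal 0 v) with hP
  have hind : iIndepFun (fun (i : Fin n) (z : Fin n → ℝ) => z i) P :=
    iIndepFun_pi (X := fun _ => id) (fun _ => aemeasurable_id)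
  have hmap : ∀ i, P.map (fun z => z i) = gaussianReal 0 v := fun i =>
    (measurePreserving_eval (fun _ : Fin n => gaussianReal 0 v) i).map_eq
  have hg : ∀ i, HasGaussianLaw (fun z : Fin n → ℝ => z i) P := fun i =>
    ⟨by rw [hmap i]; infer_instance⟩
  have hgj : HasGaussianLaw (fun z : Fin n → ℝ => (fun i => z i)) P := hind.hasGaussianLaw hg
  have hev : ∀ i, AEMeasurable (fun z : Fin n → ℝ => z i) P := fun i =>
    (measurable_pi_apply i).aemeasurable
  have hcov : ∀ i k, cov[fun z : Fin n → ℝ => z i, fun z => z k; P] = if i = k then (v : ℝ) else 0 := by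
    intro i k
    split_ifs with h
    · subst h
      rw [covariance_self (hev i)]
      have := variance_map (μ := P) (X := id) (Y := fun z => z i) (by fun_prop) (hev i)
      rw [hmap i] at this
      simp at this
      exact this.symm
    · exact (hind.indepFun h).covariance_eq_zero (hg i).memLp_two (hg k).memLp_two
  have hmean : ∀ i, ∫ z, z i ∂P = 0 := by
    intro i
    have := integral_map (μ := P) (φ := fun z => z i) (f := fun x : ℝ => x) (hev i) (by fun_prop)
    rw [hmap i, integral_id_gaussianReal] at this
    exact this.symm
  let S : Fin m → (Fin n → ℝ) → ℝ := fun j z => ∑ i, C j i / n * z i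
  have hScov : ∀ j l, cov[S j, S l; P] = if j = l then (v : ℝ) / n else 0 := by
    intro j l
    simp only [S]
    rw [covariance_fun_sum_fun_sum (fun i => (hg i).memLp_two.const_mul _)
      (fun i => (hg i).memLp_two.const_mul _)]
    simp_rw [covariance_const_mul_left, covariance_const_mul_right, hcov]
    simp only [mul_ite, mul_zero, Finset.sum_ite_eq, Finset.mem_univ, if_true]
    have : ∀ i, C j i / n * (C l i / n * v) = (v / n ^ 2) * (C j i * C l i) := by
      intro i; field_simp
    simp_rw [this]
    rw [← Finset.mul_sum, hC]
    split_ifs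
    · field_simp
    · simp
  have hSg : HasGaussianLaw (fun z => (S · z)) P := by
    let L : (Fin n → ℝ) →L[ℝ] (Fin m → ℝ) :=
      ContinuousLinearMap.pi fun j => ∑ i, (C j i / n) • ContinuousLinearMap.proj i
    have := hgj.map_fun L
    have e : (fun z => (S · z)) = fun z => L fun i => z i := by
      ext z j
      simp [S, L]
    rw [e]
    exact this
  have hSind : iIndepFun S P := hSg.iIndepFun_of_covariance_eq_zero fun i j hij => by
    rw [hScov, if_neg hij]
  have hSmean : ∀ j, ∫ z, S j z ∂P = 0 := by
    intro j
    simp only [S]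
    rw [integral_finsetSum _ (fun i _ => (hg i).integrable.const_mul _)]
    simp [integral_const_mul, hmean]
  have hSm : ∀ j, Measurable (S j) := fun j => by simp only [S]; fun_prop
  have hSmap : ∀ j, P.map (S j) = gaussianReal 0 (v / n) := by
    intro j
    rw [(hSg.eval j).map_eq_gaussianReal, hSmean, ← covariance_self (hSm j).aemeasurable, hScov]
    congr 1
    rw [if_pos rfl]
    ext
    rw [Real.coe_toNNReal _ (by positivity)]
    simp
  have hvn : v / n ≠ 0 := by
    have : (n : NNReal) ≠ 0 := by exact_mod_cast hn0
    positivity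
  have hq : ∀ j, Measurable (fun x : ℝ => a j * x + b j * x ^ 2) := fun j => by fun_prop
  have hY : ∀ j, MemLp (fun z => a j * S j z + b j * S j z ^ 2) 2 P := by
    intro j
    refine MemLp.add (((hSg.eval j).memLp_two).const_mul _) (MemLp.const_mul ?_ _)
    have h4 := (hSg.eval j).memLp (p := 4) (by norm_num)
    rw [memLp_two_iff_integrable_sq (by fun_prop)]
    have := h4.integrable_norm_pow (by norm_num : (4 : ℕ) ≠ 0)
    refine this.congr (Filter.Eventually.of_forall fun z => ?_)
    simp only [Real.norm_eq_abs]
    rw [Even.pow_abs (by decide)]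
    ring
  have hYs : ∀ j, Var[fun z => a j * S j z + b j * S j z ^ 2; P]
      = a j ^ 2 * (v / n) + 2 * b j ^ 2 * ((v : ℝ) / n) ^ 2 := by
    intro j
    have h1 := aux_var_quad (v / n) hvn (a j) (b j)
    rw [← hSmap j, variance_map (by fun_prop) (by fun_prop)] at h1
    simpa [Function.comp_def] using h1
  have hYind : iIndepFun (fun j z => a j * S j z + b j * S j z ^ 2) P :=
    hSind.comp (fun j x => a j * x + b j * x ^ 2) hq
  have hsum := IndepFun.variance_sum (s := Finset.univ) (μ := P)
    (X := fun j z => a j * S j z + b j * S j z ^ 2) (fun j _ => hY j)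
    (fun i _ j _ hij => hYind.indepFun hij)
  simp_rw [hYs] at hsum
  rw [← hsum]
  rw [variance_const_add (by fun_prop)]
  congr 1
  ext z
  simp [S]

lemma aux_ystar (d n : ℕ) (α β : Fin d → ℝ) (X : Fin n → Fin d → ℝ) (hX : Admissible d n X)
    (θs : Fin (d + 1) → ℝ) (i : Fin n) :
    yStar d n α β X θs i
      = (θs 0 + ∑ k, β k * (θs k.succ) ^ 2 / 2) + ∑ k, α k * θs k.succ * X i k := by
  have h : ∀ k, X i k ^ 2 = 1 := fun k => by
    rcases hX.1 i k with h | h <;> rw [h] <;> norm_num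
  simp only [yStar, model, h, mul_one]
  ring

lemma aux_ystar_sum (d n : ℕ) (α β : Fin d → ℝ) (X : Fin n → Fin d → ℝ) (hX : Admissible d n X)
    (θs : Fin (d + 1) → ℝ) :
    ∑ i, yStar d n α β X θs i = n * (θs 0 + ∑ k, β k * (θs k.succ) ^ 2 / 2) := by
  simp_rw [aux_ystar d n α β X hX]
  rw [Finset.sum_add_distrib, Finset.sum_comm]
  simp_rw [← Finset.mul_sum, hX.2.1]
  simp
  ring

lemma aux_lin_sum (d n : ℕ) (X : Fin n → Fin d → ℝ) (hX : Admissible d n X)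
    (c : ℝ) (g : Fin d → ℝ) (k : Fin d) :
    ∑ i, X i k * (c + ∑ l, g l * X i l) = n * g k := by
  simp_rw [mul_add, Finset.sum_add_distrib, ← Finset.sum_mul, hX.2.1, Finset.mul_sum]
  rw [Finset.sum_comm]
  have : ∀ l i, X i k * (g l * X i l) = g l * (X i k * X i l) := fun l i => by ring
  simp_rw [this, ← Finset.mul_sum, hX.2.2]
  simp
  ring

lemma aux_ystar_xsum (d n : ℕ) (α β : Fin d → ℝ) (X : Fin n → Fin d → ℝ) (hX : Admissible d n X)
    (θs : Fin (d + 1) → ℝ) (k : Fin d) :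
    ∑ i, X i k * yStar d n α β X θs i = n * (α k * θs k.succ) := by
  simp_rw [aux_ystar d n α β X hX]
  exact aux_lin_sum d n X hX _ (fun k => α k * θs k.succ) k

/-- The contrast vectors. -/
def auxC (d n : ℕ) (X : Fin n → Fin d → ℝ) : Fin (d + 1) → Fin n → ℝ :=
  Fin.cons (fun _ => 1) (fun k i => X i k)

lemma auxC_orth (d n : ℕ) (X : Fin n → Fin d → ℝ) (hX : Admissible d n X) (j l : Fin (d + 1)) :
    ∑ i, auxC d n X j i * auxC d n X l i = (n : ℝ) * (if j = l then 1 else 0) := by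
  refine Fin.cases ?_ (fun j => ?_) j <;> refine Fin.cases ?_ (fun l => ?_) l
  · simp [auxC]
  · simp [auxC, hX.2.1, (Fin.succ_ne_zero l).symm]
  · simp [auxC, hX.2.1]
  · simp [auxC, hX.2.2]

/-- Linear coefficients. -/
noncomputable def auxA (d : ℕ) (α β : Fin d → ℝ) (θs : Fin (d + 1) → ℝ) (x : Fin d → ℝ) :
    Fin (d + 1) → ℝ :=
  Fin.cons 1 (fun k => x k + β k * θs k.succ / α k * (x k ^ 2 - 1))

/-- Quadratic coefficients. -/
noncomputable def auxB (d : ℕ) (α β : Fin d → ℝ) (x : Fin d → ℝ) :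
    Fin (d + 1) → ℝ :=
  Fin.cons 0 (fun k => β k / (2 * α k ^ 2) * (x k ^ 2 - 1))

lemma aux_full (d n : ℕ) (hn : 1 ≤ n) (α β : Fin d → ℝ) (hα : ∀ k, α k ≠ 0)
    (X : Fin n → Fin d → ℝ) (hX : Admissible d n X)
    (θs : Fin (d + 1) → ℝ) (x : Fin d → ℝ) (z : Fin n → ℝ) :
    model d α β x (lse d n α β X (yStar d n α β X θs + z))
      = model d α β x θs + ∑ j, (auxA d α β θs x j * (∑ i, auxC d n X j i / n * z i)
          + auxB d α β x j * (∑ i, auxC d n X j i / n * z i) ^ 2) := by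
  have hn0 : (n : ℝ) ≠ 0 := by positivity
  have e0 : ∑ i, auxC d n X 0 i / n * z i = (∑ i, z i) / n := by
    simp [auxC, Finset.mul_sum, div_eq_inv_mul]
  have ek : ∀ k : Fin d, ∑ i, auxC d n X k.succ i / n * z i = (∑ i, X i k * z i) / n := by
    intro k
    simp only [auxC, Fin.cons_succ, Finset.sum_div]
    exact Finset.sum_congr rfl fun i _ => by ring
  have s0 : ∑ i, (yStar d n α β X θs + z) i
      = n * (θs 0 + ∑ k, β k * (θs k.succ) ^ 2 / 2) + ∑ i, z i := by
    simp only [Pi.add_apply, Finset.sum_add_distrib, aux_ystar_sum d n α β X hX]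
  have sk : ∀ k, ∑ i, X i k * (yStar d n α β X θs + z) i
      = n * (α k * θs k.succ) + ∑ i, X i k * z i := by
    intro k
    simp only [Pi.add_apply, mul_add, Finset.sum_add_distrib, aux_ystar_xsum d n α β X hX]
  rw [Fin.sum_univ_succ, e0]
  simp_rw [ek]
  unfold model lse
  simp only [Fin.cons_zero, Fin.cons_succ, s0, sk, auxA, auxB]
  generalize (∑ i, z i) = t
  generalize hT : (fun k => ∑ i, X i k * z i) = T
  have hT' : ∀ k, ∑ i, X i k * z i = T k := fun k => by rw [← hT]
  simp_rw [hT']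
  rw [show 1 / (n : ℝ) * (n * (θs 0 + ∑ k, β k * (θs k.succ) ^ 2 / 2) + t)
    = θs 0 + ∑ k, β k * (θs k.succ) ^ 2 / 2 + t / n by field_simp]
  suffices h : ∑ k, β k * (θs k.succ) ^ 2 / 2
      - ∑ k, β k / (2 * α k ^ 2 * n ^ 2) * (n * (α k * θs k.succ) + T k) ^ 2
      + ∑ k, α k * (1 / (α k * n) * (n * (α k * θs k.succ) + T k)) * x k
      + ∑ k, β k * (1 / (α k * n) * (n * (α k * θs k.succ) + T k)) ^ 2 / 2 * x k ^ 2
      = ∑ k, α k * θs k.succ * x k + ∑ k, β k * θs k.succ ^ 2 / 2 * x k ^ 2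
      + ∑ k, ((x k + β k * θs k.succ / α k * (x k ^ 2 - 1)) * (T k / n)
        + β k / (2 * α k ^ 2) * (x k ^ 2 - 1) * (T k / n) ^ 2) by
    linear_combination h
  simp only [← Finset.sum_add_distrib, ← Finset.sum_sub_distrib]
  refine Finset.sum_congr rfl fun k _ => ?_
  have := hα k
  field_simp
  ring

lemma aux_lse_star (d n : ℕ) (hn : 1 ≤ n) (α β : Fin d → ℝ) (hα : ∀ k, α k ≠ 0)
    (X : Fin n → Fin d → ℝ) (hX : Admissible d n X) (θs : Fin (d + 1) → ℝ) :
    lse d n α β X (yStar d n α β X θs) = θs := by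
  have hn0 : (n : ℝ) ≠ 0 := by positivity
  ext j
  refine Fin.cases ?_ (fun k => ?_) j
  · simp only [lse, Fin.cons_zero, aux_ystar_sum d n α β X hX, aux_ystar_xsum d n α β X hX]
    rw [show 1 / (n : ℝ) * (n * (θs 0 + ∑ k, β k * (θs k.succ) ^ 2 / 2))
      = θs 0 + ∑ k, β k * (θs k.succ) ^ 2 / 2 by field_simp]
    rw [add_sub_assoc, ← Finset.sum_sub_distrib, Finset.sum_eq_zero, add_zero]
    intro k _
    have := hα k
    field_simp
    ring
  · simp only [lse, Fin.cons_succ, aux_ystar_xsum d n α β X hX]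
    have := hα k
    field_simp

lemma aux_quad (A B : ℝ) (h : ∀ s : ℝ, 0 ≤ 2 * s * A + s ^ 2 * B) : A = 0 := by
  by_contra hA
  have hB : 0 ≤ B := by
    have h1 := h 1
    have h2 := h (-1)
    linarith
  have h1 := h (-A / (B + 1))
  have : 2 * (-A / (B + 1)) * A + (-A / (B + 1)) ^ 2 * B
      = - (A ^ 2 * (B + 2)) / (B + 1) ^ 2 := by
    field_simp
    ring
  rw [this] at h1
  have h3 : 0 < A ^ 2 * (B + 2) / (B + 1) ^ 2 := by positivity
  rw [neg_div] at h1
  linarith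

lemma aux_normal_s14 (d n : ℕ) (α β : Fin d → ℝ) (X : Fin n → Fin d → ℝ) (θb : Fin (d + 1) → ℝ)
    (w : Fin n → ℝ) (t : Fin (d + 1) → ℝ)
    (hmin : ∀ θ, sseLin d n α β X θb w t ≤ sseLin d n α β X θb w θ) (j : Fin (d + 1)) :
    ∑ i, gradModel d α β (X i) θb j * (modelLin d α β θb (X i) t - w i) = 0 := by
  refine aux_quad _ (∑ i, gradModel d α β (X i) θb j ^ 2) fun s => ?_
  have h := hmin (t + Pi.single j s)
  have e : ∀ i, modelLin d α β θb (X i) (t + Pi.single j s)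
      = modelLin d α β θb (X i) t + s * gradModel d α β (X i) θb j := by
    intro i
    unfold modelLin
    have : ∀ l, gradModel d α β (X i) θb l * ((t + Pi.single j s : Fin (d + 1) → ℝ) l - θb l)
        = gradModel d α β (X i) θb l * (t l - θb l)
          + (if l = j then s * gradModel d α β (X i) θb l else 0) := by
      intro l
      rw [Pi.add_apply, Pi.single_apply]
      split_ifs <;> ring
    simp_rw [this, Finset.sum_add_distrib]
    simp [add_assoc]
  unfold sseLin at h
  simp_rw [e] at h
  rw [← sub_nonneg, ← Finset.sum_sub_distrib] at h
  rw [Finset.mul_sum, Finset.mul_sum, ← Finset.sum_add_distrib]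
  refine h.trans_eq (Finset.sum_congr rfl fun i _ => by ring)

lemma aux_lin (d n : ℕ) (hn : 1 ≤ n) (α β : Fin d → ℝ) (hα : ∀ k, α k ≠ 0)
    (X : Fin n → Fin d → ℝ) (hX : Admissible d n X)
    (θs : Fin (d + 1) → ℝ) (x : Fin d → ℝ) (z : Fin n → ℝ) (t : Fin (d + 1) → ℝ)
    (hmin : ∀ θ, sseLin d n α β X θs (yStar d n α β X θs + z) t
      ≤ sseLin d n α β X θs (yStar d n α β X θs + z) θ) :
    modelLin d α β θs x t
      = model d α β x θs + ∑ j, (auxA d α β θs x j * (∑ i, auxC d n X j i / n * z i)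
          + 0 * (∑ i, auxC d n X j i / n * z i) ^ 2) := by
  have hn0 : (n : ℝ) ≠ 0 := by positivity
  have e0 : ∑ i, auxC d n X 0 i / n * z i = (∑ i, z i) / n := by
    simp [auxC, Finset.mul_sum, div_eq_inv_mul]
  have ek : ∀ k : Fin d, ∑ i, auxC d n X k.succ i / n * z i = (∑ i, X i k * z i) / n := by
    intro k
    simp only [auxC, Fin.cons_succ, Finset.sum_div]
    exact Finset.sum_congr rfl fun i _ => by ring
  have hnorm := aux_normal_s14 d n α β X θs _ t hmin
  set δ : Fin d → ℝ := fun k => t k.succ - θs k.succ with hδ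
  set c : ℝ := (t 0 - θs 0) + ∑ k, β k * θs k.succ * δ k with hc
  have hr : ∀ i, modelLin d α β θs (X i) t - (yStar d n α β X θs + z) i
      = (c + ∑ k, (α k * δ k) * X i k) - z i := by
    intro i
    have h : ∀ k, X i k ^ 2 = 1 := fun k => by
      rcases hX.1 i k with h | h <;> rw [h] <;> norm_num
    simp only [modelLin, Fin.sum_univ_succ, gradModel, Fin.cons_zero, Fin.cons_succ, Pi.add_apply,
      yStar, h, hc]
    have : ∑ k, (α k * X i k + β k * θs k.succ * 1) * (t k.succ - θs k.succ)
        = ∑ k, β k * θs k.succ * δ k + ∑ k, (α k * δ k) * X i k := by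
      rw [← Finset.sum_add_distrib]
      exact Finset.sum_congr rfl fun k _ => by simp only [hδ]; ring
    rw [this]
    ring
  simp_rw [hr] at hnorm
  have h0 : ∑ i, ((c + ∑ k, (α k * δ k) * X i k) - z i) = 0 := by
    simpa [gradModel] using hnorm 0
  have hk : ∀ k, ∑ i, X i k * ((c + ∑ k, (α k * δ k) * X i k) - z i) = 0 := by
    intro k
    have h1 := hnorm k.succ
    have h2 : ∀ i, gradModel d α β (X i) θs k.succ * ((c + ∑ k, (α k * δ k) * X i k) - z i)
        = α k * (X i k * ((c + ∑ k, (α k * δ k) * X i k) - z i))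
          + β k * θs k.succ * ((c + ∑ k, (α k * δ k) * X i k) - z i) := by
      intro i
      have h : X i k ^ 2 = 1 := by
        rcases hX.1 i k with h | h <;> rw [h] <;> norm_num
      simp only [gradModel, Fin.cons_succ, h]
      ring
    simp_rw [h2] at h1
    rw [Finset.sum_add_distrib, ← Finset.mul_sum, ← Finset.mul_sum, h0, mul_zero, add_zero] at h1
    exact (mul_eq_zero.1 h1).resolve_left (hα k)
  have hcv : c = (∑ i, z i) / n := by
    rw [Finset.sum_sub_distrib, Finset.sum_add_distrib, Finset.sum_comm] at h0
    simp_rw [← Finset.mul_sum, hX.2.1] at h0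
    simp at h0
    field_simp
    linarith
  have hdv : ∀ k, δ k = (∑ i, X i k * z i) / n / α k := by
    intro k
    have h1 := hk k
    simp_rw [mul_sub] at h1
    rw [Finset.sum_sub_distrib, aux_lin_sum d n X hX c (fun k => α k * δ k) k] at h1
    have := hα k
    field_simp
    linarith
  rw [Fin.sum_univ_succ, e0]
  simp_rw [ek]
  simp only [modelLin, Fin.sum_univ_succ, gradModel, Fin.cons_zero, Fin.cons_succ, auxA, ← hcv]
  suffices h : ∑ k, (α k * x k + β k * θs k.succ * x k ^ 2) * (t k.succ - θs k.succ)
      = ∑ k, β k * θs k.succ * δ k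
      + ∑ k, ((x k + β k * θs k.succ / α k * (x k ^ 2 - 1)) * ((∑ i, X i k * z i) / n)
        + 0 * ((∑ i, X i k * z i) / n) ^ 2) by
    rw [h, hc]
    ring
  rw [← Finset.sum_add_distrib]
  refine Finset.sum_congr rfl fun k _ => ?_
  rw [show t k.succ - θs k.succ = δ k from rfl, hdv k]
  have := hα k
  field_simp
  ring

open ProbabilityTheory in
lemma aux_var_eq (n : ℕ) (σ : ℝ) (hσ : 0 < σ) (v : NNReal) (hv : (v : ℝ) = σ ^ 2)
    (f : (Fin n → ℝ) → ℝ) (hf : Measurable f) :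
    ∫ z, (f z - ∫ w, f w * gauss n σ w) ^ 2 * gauss n σ z
      = Var[f; Measure.pi (fun _ : Fin n => gaussianReal 0 v)] := by
  rw [aux_integral n σ hσ v hv f,
    aux_integral n σ hσ v hv (fun z => (f z - _) ^ 2), variance_eq_integral hf.aemeasurable]

/-- With noise-free observations `y = y*` (so `θ̄ = θ̂(y*) = θ*`), the exact
prediction uncertainty exceeds the linearization approximation by the stated amount. -/
theorem stmt14 (d n : ℕ) (hd : 1 ≤ d) (hn : 1 ≤ n)
    (α β : Fin d → ℝ) (hα : ∀ k, α k ≠ 0)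
    (X : Fin n → Fin d → ℝ) (hX : Admissible d n X)
    (θs : Fin (d + 1) → ℝ) (σ : ℝ) (hσ : 0 < σ)
    (θb : Fin (d + 1) → ℝ) (hθb : θb = lse d n α β X (yStar d n α β X θs))
    (tLin : (Fin n → ℝ) → Fin (d + 1) → ℝ)
    (hmin : ∀ (w : Fin n → ℝ) (θ : Fin (d + 1) → ℝ),
      sseLin d n α β X θb w (tLin w) ≤ sseLin d n α β X θb w θ)
    (x : Fin d → ℝ) (hx : ∀ k, x k ∈ Set.Icc (-1 : ℝ) 1) :
    predVar d n α β X θs σ x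
        - (∫ z : Fin n → ℝ,
            (modelLin d α β θb x (tLin (yStar d n α β X θs + z))
                - ∫ w : Fin n → ℝ,
                    modelLin d α β θb x (tLin (yStar d n α β X θs + w)) * gauss n σ w) ^ 2
              * gauss n σ z)
      = σ ^ 4 / (2 * (n : ℝ) ^ 2)
          * ∑ k, (β k) ^ 2 / (α k) ^ 4 * ((x k) ^ 2 - 1) ^ 2 := by
  have hb : θb = θs := by rw [hθb, aux_lse_star d n hn α β hα X hX θs]
  subst hb
  have hn0 : (n : ℝ) ≠ 0 := by positivity
  let v : NNReal := ⟨σ ^ 2, by positivity⟩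
  have hv : (v : ℝ) = σ ^ 2 := rfl
  have hv0 : v ≠ 0 := by
    intro h
    rw [h] at hv
    have : 0 < σ ^ 2 := by positivity
    simp at hv
    linarith
  unfold predVar predMean
  simp_rw [aux_full d n hn α β hα X hX, fun z => aux_lin d n hn α β hα X hX θb x z
    (tLin (yStar d n α β X θb + z)) (hmin _)]
  rw [aux_var_eq n σ hσ v hv (fun z => model d α β x θb + ∑ j, (auxA d α β θb x j *
      (∑ i, auxC d n X j i / n * z i)
        + auxB d α β x j * (∑ i, auxC d n X j i / n * z i) ^ 2)) (by fun_prop),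
    aux_var_eq n σ hσ v hv (fun z => model d α β x θb + ∑ j, (auxA d α β θb x j *
      (∑ i, auxC d n X j i / n * z i)
        + 0 * (∑ i, auxC d n X j i / n * z i) ^ 2)) (by fun_prop),
    aux_var_main (d + 1) n hn v hv0 _ (auxC_orth d n X hX),
    aux_var_main (d + 1) n hn v hv0 _ (auxC_orth d n X hX) _ (fun _ => 0),
    ← Finset.sum_sub_distrib, Fin.sum_univ_succ, Finset.mul_sum, hv]
  simp only [auxB, Fin.cons_zero, Fin.cons_succ]
  rw [show ∀ a b : ℝ, (a + 2 * 0 ^ 2 * b) - (a + 2 * 0 ^ 2 * b) = 0 from fun a b => by ring, zero_add]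
  refine Finset.sum_congr rfl fun k _ => ?_
  have := hα k
  field_simp
  ring
end
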